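/- Let S_λ be a weighted shift on a directed tree 𝒯 = (V, E) with weights λ = {λ_v}_{v ∈ V°} ⊆ ℂ and let n be a nonnegative integer. Then S_λ^n is densely defined if and only if e_u ∈ D(S_λ^n) for every branching vertex u ∈ V_≺. -/

import Mathlib

open MeasureTheory ENNReal NNReal

/-- `E` is the edge relation of a directed tree: every vertex has at most one parent,
there are no (directed) circuits, and the underlying undirected graph is connected. -/
structure IsDirectedTree {V : Type*} (E : V → V → Prop) : Prop where
  nonempty : Nonempty V
  parent_unique : ∀ ⦃u u' v : V⦄, E u v → E u' v → u = u'
  no_circuit : ∀ (k : ℕ) (c : ℕ → V), 1 ≤ k → (∀ i < k, E (c i) (c (i + 1))) → c 0 ≠ c k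
  connected : ∀ u v : V, Relation.ReflTransGen (fun a b : V => E a b ∨ E b a) u v

/-- `v ∈ V°`, i.e. `v` has a parent. -/
def HasParent {V : Type*} (E : V → V → Prop) (v : V) : Prop := ∃ u, E u v

/-- `u` is a branching vertex: it has at least two children. -/
def IsBranching {V : Type*} (E : V → V → Prop) (u : V) : Prop :=
  ∃ v w : V, E u v ∧ E u w ∧ v ≠ w

open scoped Classical in
/-- The formal action `Λ_𝒯` of the weighted shift with weights `lam` (only the values of
`lam` on `V°` matter): `(Λ f)(v) = λ_v f(par v)` for `v ∈ V°` and `0` otherwise. -/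
noncomputable def shiftFun {V : Type*} (E : V → V → Prop) (lam : V → ℂ) (f : V → ℂ) :
    V → ℂ :=
  fun v => if h : ∃ u, E u v then lam v * f (Classical.choose h) else 0

/-- The (natural) domain of the `n`-th power of the weighted shift `S_λ`, described as a set
of functions: `f ∈ D(S_λ^n)` iff `Λ^k f ∈ ℓ²(V)` for all `k ≤ n`. This agrees with the
recursive definition `D(S^0) = ℓ²(V)`, `D(S^{n+1}) = {f ∈ D(S^n) : S^n f ∈ D(S)}`. -/
noncomputable def domPow {V : Type*} (E : V → V → Prop) (lam : V → ℂ) (n : ℕ) :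
    Set (V → ℂ) :=
  {f | ∀ k ≤ n, Memℓp ((shiftFun E lam)^[k] f) 2}

/-- `S_λ^n` is densely defined, i.e. `D(S_λ^n)` is dense in `ℓ²(V)`. -/
noncomputable def DenselyDefinedPow {V : Type*} (E : V → V → Prop) (lam : V → ℂ)
    (n : ℕ) : Prop :=
  Dense {f : lp (fun _ : V => ℂ) 2 | (⇑f : V → ℂ) ∈ domPow E lam n}

/-- `e_u`, the characteristic function of `{u}`. -/
noncomputable def eFun {V : Type*} (u : V) : V → ℂ := ({u} : Set V).indicator 1

/-- The formal shift `shiftFun` as a linear map on all functions. -/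
noncomputable def shiftLin {V : Type*} (E : V → V → Prop) (lam : V → ℂ) :
    (V → ℂ) →ₗ[ℂ] (V → ℂ) where
  toFun := shiftFun E lam
  map_add' f g := by
    funext v
    simp only [shiftFun, Pi.add_apply]
    split_ifs <;> ring
  map_smul' c f := by
    funext v
    simp only [shiftFun, Pi.smul_apply, smul_eq_mul, RingHom.id_apply]
    split_ifs <;> ring

lemma shiftFun_iterate_eq_pow {V : Type*} (E : V → V → Prop) (lam : V → ℂ) (k : ℕ)
    (f : V → ℂ) : (shiftFun E lam)^[k] f = (shiftLin E lam ^ k) f :=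
  (Module.End.pow_apply (shiftLin E lam) k f).symm

lemma shiftFun_apply_of_edge {V : Type*} {E : V → V → Prop} (hT : IsDirectedTree E)
    (lam : V → ℂ) (f : V → ℂ) {u v : V} (h : E u v) :
    shiftFun E lam f v = lam v * f u := by
  have hv : ∃ u, E u v := ⟨u, h⟩
  rw [shiftFun, dif_pos hv, hT.parent_unique (Classical.choose_spec hv) h]

lemma shiftFun_apply_of_not_hasParent {V : Type*} {E : V → V → Prop} (lam : V → ℂ)
    (f : V → ℂ) {v : V} (h : ¬ HasParent E v) : shiftFun E lam f v = 0 :=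
  dif_neg h

@[simp]
lemma eFun_self {V : Type*} (u : V) : eFun u u = 1 := by
  simp [eFun]

lemma eFun_of_ne {V : Type*} {u v : V} (h : v ≠ u) : eFun u v = 0 := by
  simp [eFun, h]

lemma lp_single_eq_smul_eFun {V : Type*} [DecidableEq V] (u : V) (c : ℂ) :
    (⇑(lp.single (E := fun _ : V => ℂ) 2 u c) : V → ℂ) = c • eFun u := by
  funext v
  by_cases h : v = u
  · subst h
    simp
  · simp [eFun_of_ne h, h]

lemma memℓp_eFun {V : Type*} (u : V) : Memℓp (eFun u) 2 := by
  classical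
  have h := lp.memℓp (lp.single (E := fun _ : V => ℂ) 2 u 1)
  rwa [lp_single_eq_smul_eFun, one_smul] at h

/-- `D(S_λ^n)` as a linear subspace of `ℓ²(V)`. -/
noncomputable def domPowSubmodule {V : Type*} (E : V → V → Prop) (lam : V → ℂ) (n : ℕ) :
    Submodule ℂ (lp (fun _ : V => ℂ) 2) where
  carrier := {f | (⇑f : V → ℂ) ∈ domPow E lam n}
  zero_mem' k _ := by
    rw [shiftFun_iterate_eq_pow, lp.coeFn_zero, map_zero]
    exact zero_memℓp
  add_mem' {f g} hf hg k hk := by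
    rw [shiftFun_iterate_eq_pow, lp.coeFn_add, map_add, ← shiftFun_iterate_eq_pow,
      ← shiftFun_iterate_eq_pow]
    exact (hf k hk).add (hg k hk)
  smul_mem' c f hf k hk := by
    rw [shiftFun_iterate_eq_pow, lp.coeFn_smul, map_smul, ← shiftFun_iterate_eq_pow]
    exact (hf k hk).const_smul c

/-- Each iterate of the shift on `eFun u` either vanishes at `v` or determines the corresponding
iterate on `f` there, because every vertex has only one ancestor of each order. -/
lemma shiftFun_iterate_eFun_eq_zero_or {V : Type*} (E : V → V → Prop) (lam : V → ℂ)
    (f : V → ℂ) (u : V) (k : ℕ) (v : V) :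
    (shiftFun E lam)^[k] (eFun u) v = 0 ∨
      (shiftFun E lam)^[k] f v = f u * (shiftFun E lam)^[k] (eFun u) v := by
  induction k generalizing v with
  | zero =>
    by_cases h : v = u
    · subst h
      simp
    · exact Or.inl (eFun_of_ne h)
  | succ k ih =>
    simp only [Function.iterate_succ_apply']
    by_cases h : ∃ w, E w v
    · simp only [shiftFun, dif_pos h]
      rcases ih (Classical.choose h) with h0 | h1
      · exact Or.inl (by rw [h0, mul_zero])
      · exact Or.inr (by rw [h1]; ring)
    · exact Or.inl (shiftFun_apply_of_not_hasParent lam _ h)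

lemma eFun_mem_domPow_of_apply_ne_zero {V : Type*} {E : V → V → Prop} {lam : V → ℂ} {n : ℕ}
    {f : V → ℂ} (hf : f ∈ domPow E lam n) {u : V} (hu : f u ≠ 0) :
    eFun u ∈ domPow E lam n := by
  intro k hk
  refine ((hf k hk).const_smul (f u)⁻¹).mono' fun v => ?_
  rcases shiftFun_iterate_eFun_eq_zero_or E lam f u k v with h | h
  · rw [h, norm_zero]
    exact norm_nonneg _
  · rw [Pi.smul_apply, h, smul_eq_mul, inv_mul_cancel_left₀ hu]

lemma DenselyDefinedPow.eFun_mem_domPow {V : Type*} {E : V → V → Prop} {lam : V → ℂ} {n : ℕ}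
    (h : DenselyDefinedPow E lam n) (u : V) : eFun u ∈ domPow E lam n := by
  classical
  obtain ⟨f, hf, hdist⟩ := h.exists_dist_lt
    (lp.single (E := fun _ : V => ℂ) 2 u 1) one_pos
  refine eFun_mem_domPow_of_apply_ne_zero hf (u := u) fun h0 => ?_
  have hle := lp.norm_apply_le_norm two_ne_zero
    (lp.single (E := fun _ : V => ℂ) 2 u 1 - f) u
  rw [← dist_eq_norm, lp.coeFn_sub, Pi.sub_apply, h0, lp_single_eq_smul_eFun] at hle
  exact absurd hdist (not_lt.mpr (by simpa using hle))

lemma DenselyDefinedPow.of_eFun_mem_domPow {V : Type*} {E : V → V → Prop} {lam : V → ℂ}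
    {n : ℕ} (h : ∀ u, eFun u ∈ domPow E lam n) : DenselyDefinedPow E lam n := by
  classical
  intro f
  have hmem (u : V) (c : ℂ) : lp.single 2 u c ∈ domPowSubmodule E lam n := by
    intro k hk
    rw [lp_single_eq_smul_eFun, shiftFun_iterate_eq_pow, map_smul, ← shiftFun_iterate_eq_pow]
    exact (h u k hk).const_smul c
  exact mem_closure_of_tendsto (lp.hasSum_single ENNReal.ofNat_ne_top f)
    (Filter.Eventually.of_forall fun s =>
      (domPowSubmodule E lam n).sum_mem fun u _ => hmem u (f u))

lemma shiftFun_eFun_of_not_isBranching {V : Type*} {E : V → V → Prop} (hT : IsDirectedTree E)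
    (lam : V → ℂ) {u : V} (hu : ¬ IsBranching E u) :
    ∃ (c : ℂ) (w : V), shiftFun E lam (eFun u) = c • eFun w := by
  have hchild {v : V} (h : ¬ E u v) : shiftFun E lam (eFun u) v = 0 := by
    by_cases hp : HasParent E v
    · obtain ⟨p, hp⟩ := hp
      have hpu : p ≠ u := by
        rintro rfl
        exact h hp
      rw [shiftFun_apply_of_edge hT lam _ hp, eFun_of_ne hpu, mul_zero]
    · exact shiftFun_apply_of_not_hasParent lam _ hp
  by_cases hw : ∃ w, E u w
  · obtain ⟨w, hw⟩ := hw
    refine ⟨lam w, w, funext fun v => ?_⟩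
    by_cases hv : v = w
    · subst hv
      simp [shiftFun_apply_of_edge hT lam _ hw]
    · rw [hchild fun h => hu ⟨v, w, h, hw, hv⟩, Pi.smul_apply, eFun_of_ne hv, smul_zero]
  · refine ⟨0, u, funext fun v => ?_⟩
    rw [hchild fun h => hw ⟨v, h⟩, zero_smul, Pi.zero_apply]

lemma eFun_mem_domPow_of_isBranching {V : Type*} {E : V → V → Prop} (hT : IsDirectedTree E)
    {lam : V → ℂ} {n : ℕ} (h : ∀ u, IsBranching E u → eFun u ∈ domPow E lam n) (u : V) :
    eFun u ∈ domPow E lam n := by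
  intro k hk
  induction k generalizing u with
  | zero => exact memℓp_eFun u
  | succ k ih =>
    by_cases hu : IsBranching E u
    · exact h u hu (k + 1) hk
    · obtain ⟨c, w, hw⟩ := shiftFun_eFun_of_not_isBranching hT lam hu
      rw [Function.iterate_succ_apply, hw, shiftFun_iterate_eq_pow, map_smul,
        ← shiftFun_iterate_eq_pow]
      exact (ih w (Nat.le_of_succ_le hk)).const_smul c

/-- Lemma (ddn): `S_λ^n` is densely defined iff `e_u ∈ D(S_λ^n)` for every branching
vertex `u ∈ V_≺`. -/
theorem stmt_3 {V : Type*} (E : V → V → Prop) (hT : IsDirectedTree E) (lam : V → ℂ)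
    (n : ℕ) :
    DenselyDefinedPow E lam n ↔ ∀ u : V, IsBranching E u → eFun u ∈ domPow E lam n := by
  exact ⟨fun h u _ => h.eFun_mem_domPow u,
    fun h => .of_eFun_mem_domPow (eFun_mem_domPow_of_isBranching hT h)⟩
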